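/- arXiv:solv-int/9701008 — 2 statements merged into one kernel-verified Lean document; each statement's English description precedes it below -/
import Mathlib

section
/- For all smooth g, h : ℝ → ℝ, the Lie bracket of the vector fields Y(g) and X(h) on ℝ⁴ satisfies [Y(g), X(h)] = W(m) pointwise, where m(t) = (4/9)(h(t)g''(t) − g'(t)h'(t)) − (8/9)g(t)h''(t). -/
noncomputable section

/-- The space ℝ⁴, with coordinates (x, y, t, w). -/
abbrev E : Type := ℝ × ℝ × ℝ × ℝ

/-- Lie bracket of vector fields on ℝ⁴:
`[V, W](p) = DW(p)(V(p)) − DV(p)(W(p))`. -/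
def lie (V W : E → E) : E → E :=
  fun p => fderiv ℝ W p (V p) - fderiv ℝ V p (W p)

/-- The Virasoro vector field `T(f)`. -/
def Tf (f : ℝ → ℝ) : E → E := fun p =>
  ((1/3) * p.1 * deriv f p.2.2.1 + (2/9) * p.2.1 ^ 2 * deriv (deriv f) p.2.2.1,
   (2/3) * p.2.1 * deriv f p.2.2.1,
   f p.2.2.1,
   -((1/3) * p.2.2.2 * deriv f p.2.2.1 + (1/9) * p.1 ^ 2 * deriv (deriv f) p.2.2.1
     + (4/27) * p.1 * p.2.1 ^ 2 * deriv (deriv (deriv f)) p.2.2.1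
     + (4/243) * p.2.1 ^ 4 * deriv (deriv (deriv (deriv f))) p.2.2.1))

/-- The Kac–Moody vector field `Y(g)`. -/
def Yf (g : ℝ → ℝ) : E → E := fun p =>
  ((2/3) * p.2.1 * deriv g p.2.2.1,
   g p.2.2.1,
   0,
   -((4/9) * p.1 * p.2.1 * deriv (deriv g) p.2.2.1
     + (8/81) * p.2.1 ^ 3 * deriv (deriv (deriv g)) p.2.2.1))

/-- The Kac–Moody vector field `X(h)`. -/
def Xf (h : ℝ → ℝ) : E → E := fun p =>
  (h p.2.2.1, 0, 0, -((2/3) * p.1 * deriv h p.2.2.1 + (4/9) * p.2.1 ^ 2 * deriv (deriv h) p.2.2.1))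

/-- The Kac–Moody vector field `W(k)`. -/
def Wf (k : ℝ → ℝ) : E → E := fun p =>
  (0, 0, 0, p.2.1 * k p.2.2.1)

/-- The Kac–Moody vector field `U(ℓ)`. -/
def Uf (l : ℝ → ℝ) : E → E := fun p =>
  (0, 0, 0, l p.2.2.1)

/-- A smooth function of the coordinate `t` has differential `f'(t) dt`. -/
theorem hasFDerivAt_comp_t {f : ℝ → ℝ} (hf : ContDiff ℝ (⊤ : ℕ∞) f) (p : E) :
    HasFDerivAt (fun q : E => f q.2.2.1)
      (deriv f p.2.2.1 • (ContinuousLinearMap.fst ℝ ℝ ℝ ∘L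
        ContinuousLinearMap.snd ℝ ℝ (ℝ × ℝ) ∘L ContinuousLinearMap.snd ℝ ℝ (ℝ × ℝ × ℝ))) p :=
  ((hf.differentiable (by simp)) p.2.2.1).hasDerivAt.comp_hasFDerivAt (f := fun q : E => q.2.2.1) p
    (hasFDerivAt_fst.comp p (hasFDerivAt_snd.comp p hasFDerivAt_snd))

theorem contDiff_deriv {f : ℝ → ℝ} (hf : ContDiff ℝ (⊤ : ℕ∞) f) :
    ContDiff ℝ (⊤ : ℕ∞) (deriv f) :=
  (contDiff_infty_iff_deriv.1 hf).2

/-- The differential of `Y(g)` at `p`, applied to `v`. -/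
theorem fderiv_Yf_apply {g : ℝ → ℝ} (hg : ContDiff ℝ (⊤ : ℕ∞) g) (p v : E) :
    fderiv ℝ (Yf g) p v =
      ((2/3) * (v.2.1 * deriv g p.2.2.1 + p.2.1 * deriv (deriv g) p.2.2.1 * v.2.2.1),
       deriv g p.2.2.1 * v.2.2.1,
       0,
       -((4/9) * ((v.1 * p.2.1 + p.1 * v.2.1) * deriv (deriv g) p.2.2.1
            + p.1 * p.2.1 * deriv (deriv (deriv g)) p.2.2.1 * v.2.2.1)
          + (8/81) * (3 * p.2.1 ^ 2 * v.2.1 * deriv (deriv (deriv g)) p.2.2.1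
            + p.2.1 ^ 3 * deriv (deriv (deriv (deriv g))) p.2.2.1 * v.2.2.1))) := by
  have hg1 := contDiff_deriv hg
  have hg2 := contDiff_deriv hg1
  have hg3 := contDiff_deriv hg2
  have hx : HasFDerivAt (fun q : E => q.1) (ContinuousLinearMap.fst ℝ ℝ (ℝ × ℝ × ℝ)) p := hasFDerivAt_fst
  have hy : HasFDerivAt (fun q : E => q.2.1) (ContinuousLinearMap.fst ℝ ℝ (ℝ × ℝ) ∘L
      ContinuousLinearMap.snd ℝ ℝ (ℝ × ℝ × ℝ)) p := hasFDerivAt_fst.comp p hasFDerivAt_snd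
  have key : HasFDerivAt (Yf g) _ p :=
    ((hy.const_mul (2/3)).mul (hasFDerivAt_comp_t hg1 p)).prodMk
      ((hasFDerivAt_comp_t hg p).prodMk
        ((hasFDerivAt_const (0 : ℝ) p).prodMk
          ((((hx.const_mul (4/9)).mul hy).mul (hasFDerivAt_comp_t hg2 p)).add
            (((hy.pow 3).const_mul (8/81)).mul (hasFDerivAt_comp_t hg3 p))).neg))
  rw [key.fderiv]
  ext <;> simp <;> ring

/-- The differential of `X(h)` at `p`, applied to `v`. -/
theorem fderiv_Xf_apply {h : ℝ → ℝ} (hh : ContDiff ℝ (⊤ : ℕ∞) h) (p v : E) :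
    fderiv ℝ (Xf h) p v =
      (deriv h p.2.2.1 * v.2.2.1,
       0,
       0,
       -((2/3) * (v.1 * deriv h p.2.2.1 + p.1 * deriv (deriv h) p.2.2.1 * v.2.2.1)
          + (4/9) * (2 * p.2.1 * v.2.1 * deriv (deriv h) p.2.2.1
            + p.2.1 ^ 2 * deriv (deriv (deriv h)) p.2.2.1 * v.2.2.1))) := by
  have hh1 := contDiff_deriv hh
  have hh2 := contDiff_deriv hh1
  have hx : HasFDerivAt (fun q : E => q.1) (ContinuousLinearMap.fst ℝ ℝ (ℝ × ℝ × ℝ)) p := hasFDerivAt_fst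
  have hy : HasFDerivAt (fun q : E => q.2.1) (ContinuousLinearMap.fst ℝ ℝ (ℝ × ℝ) ∘L
      ContinuousLinearMap.snd ℝ ℝ (ℝ × ℝ × ℝ)) p := hasFDerivAt_fst.comp p hasFDerivAt_snd
  have key : HasFDerivAt (Xf h) _ p :=
    (hasFDerivAt_comp_t hh p).prodMk
      ((hasFDerivAt_const (0 : ℝ) p).prodMk
        ((hasFDerivAt_const (0 : ℝ) p).prodMk
          (((hx.const_mul (2/3)).mul (hasFDerivAt_comp_t hh1 p)).add
            (((hy.pow 2).const_mul (4/9)).mul (hasFDerivAt_comp_t hh2 p))).neg))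
  rw [key.fderiv]
  ext <;> simp
  ring

/-- `[Y(g), X(h)] = W((4/9)(hg'' − g'h') − (8/9)gh'')`. -/
theorem stmt7 (g h : ℝ → ℝ) (hg : ContDiff ℝ (⊤ : ℕ∞) g) (hh : ContDiff ℝ (⊤ : ℕ∞) h) :
    ∀ p : E, lie (Yf g) (Xf h) p
      = Wf (fun t => (4/9) * (h t * deriv (deriv g) t - deriv g t * deriv h t)
          - (8/9) * g t * deriv (deriv h) t) p := by
  intro p
  rw [lie, fderiv_Xf_apply hh, fderiv_Yf_apply hg]
  ext <;> simp [Xf, Yf, Wf]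
  ring
end
end

section
/- Let w : ℝ³ → ℝ be a smooth solution of the KP₄ equation and let f : ℝ → ℝ be smooth. Define Q : ℝ³ → ℝ by Q = f(t)∂_t w + (1/4)f'(t)(x∂ₓw + 2y∂_yw) + (1/4)(w f'(t) + x y f''(t)). Then Q satisfies the linearized KP₄ equation at w; that is, the Virasoro (time-reparametrization) flow T(f) is a symmetry of the KP₄ equation for every smooth f. -/
noncomputable section

/-- Partial derivative in the first variable `x`. -/
def dx (w : ℝ → ℝ → ℝ → ℝ) : ℝ → ℝ → ℝ → ℝ :=
  fun x y t => deriv (fun s => w s y t) x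

/-- Partial derivative in the second variable `y`. -/
def dy (w : ℝ → ℝ → ℝ → ℝ) : ℝ → ℝ → ℝ → ℝ :=
  fun x y t => deriv (fun s => w x s t) y

/-- Partial derivative in the third variable `t`. -/
def dt (w : ℝ → ℝ → ℝ → ℝ) : ℝ → ℝ → ℝ → ℝ :=
  fun x y t => deriv (fun s => w x y s) t

/-- Smoothness of a function of three real variables. -/
def Smooth3 (w : ℝ → ℝ → ℝ → ℝ) : Prop :=
  ContDiff ℝ (⊤ : ℕ∞) (fun p : ℝ × ℝ × ℝ => w p.1 p.2.1 p.2.2)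

/-- The fourth equation of the KP hierarchy (KP₄). -/
def KP4 (w : ℝ → ℝ → ℝ → ℝ) : Prop :=
  ∀ x y t,
      dx (dx (dx (dx (dy w)))) x y t
    + 6 * dx (dx w) x y t * dx (dy w) x y t
    + 4 * dx w x y t * dx (dx (dy w)) x y t
    + 2 * dx (dx (dx w)) x y t * dy w x y t
    - 2 * dx (dx (dt w)) x y t
    + dy (dy (dy w)) x y t = 0

/-- The linearization of the KP₄ equation at a solution `w`. -/
def LinKP4 (w Q : ℝ → ℝ → ℝ → ℝ) : Prop :=
  ∀ x y t,
      dx (dx (dx (dx (dy Q)))) x y t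
    + 6 * (dx (dx Q) x y t * dx (dy w) x y t + dx (dx w) x y t * dx (dy Q) x y t)
    + 4 * (dx Q x y t * dx (dx (dy w)) x y t + dx w x y t * dx (dx (dy Q)) x y t)
    + 2 * (dx (dx (dx Q)) x y t * dy w x y t + dx (dx (dx w)) x y t * dy Q x y t)
    - 2 * dx (dx (dt Q)) x y t
    + dy (dy (dy Q)) x y t = 0

/-- A function of three variables regarded as a function on `ℝ × ℝ × ℝ`. -/
def uncurry3 (w : ℝ → ℝ → ℝ → ℝ) : ℝ × ℝ × ℝ → ℝ := fun p => w p.1 p.2.1 p.2.2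

/-- The directional derivative of a function of three variables along `v`. -/
def dirDeriv (v : ℝ × ℝ × ℝ) (w : ℝ → ℝ → ℝ → ℝ) : ℝ → ℝ → ℝ → ℝ :=
  fun x y t => fderiv ℝ (uncurry3 w) (x, y, t) v

lemma Smooth3.differentiable {w : ℝ → ℝ → ℝ → ℝ} (hw : Smooth3 w) :
    Differentiable ℝ (uncurry3 w) :=
  ContDiff.differentiable hw (by simp)

lemma Smooth3.dirDeriv {w : ℝ → ℝ → ℝ → ℝ} (hw : Smooth3 w) (v : ℝ × ℝ × ℝ) :
    Smooth3 (dirDeriv v w) :=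
  (ContDiff.fderiv_right (m := (⊤ : ℕ∞)) hw (by simp)).clm_apply contDiff_const

lemma dirDeriv_comm {w : ℝ → ℝ → ℝ → ℝ} (hw : Smooth3 w) (u v : ℝ × ℝ × ℝ) :
    dirDeriv u (dirDeriv v w) = dirDeriv v (dirDeriv u w) := by
  have hd : Differentiable ℝ (fderiv ℝ (uncurry3 w)) :=
    (ContDiff.fderiv_right (m := (⊤ : ℕ∞)) hw (by simp)).differentiable (by simp)
  have key : ∀ (a b : ℝ × ℝ × ℝ) (x y t : ℝ), dirDeriv a (dirDeriv b w) x y t =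
      fderiv ℝ (fderiv ℝ (uncurry3 w)) (x, y, t) a b := by
    intro a b x y t
    change fderiv ℝ (fun p => fderiv ℝ (uncurry3 w) p b) (x, y, t) a = _
    rw [fderiv_clm_apply (hd _) (differentiableAt_const _)]
    simp
  funext x y t
  rw [key, key]
  have hs : ContDiffAt ℝ (⊤ : ℕ∞) (uncurry3 w) (x, y, t) := ContDiff.contDiffAt hw
  refine (hs.isSymmSndFDerivAt ?_).eq u v
  rw [minSmoothness_of_isRCLikeNormedField]
  exact WithTop.coe_le_coe.2 le_top

lemma dirDeriv_add {a b : ℝ → ℝ → ℝ → ℝ} (ha : Smooth3 a) (hb : Smooth3 b)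
    (v : ℝ × ℝ × ℝ) : dirDeriv v (a + b) = dirDeriv v a + dirDeriv v b := by
  funext x y t
  change fderiv ℝ (uncurry3 a + uncurry3 b) (x, y, t) v = _
  rw [fderiv_add (ha.differentiable _) (hb.differentiable _)]
  rfl

lemma dirDeriv_mul {a b : ℝ → ℝ → ℝ → ℝ} (ha : Smooth3 a) (hb : Smooth3 b)
    (v : ℝ × ℝ × ℝ) : dirDeriv v (a * b) = dirDeriv v a * b + a * dirDeriv v b := by
  funext x y t
  change fderiv ℝ (uncurry3 a * uncurry3 b) (x, y, t) v = _
  rw [fderiv_mul (ha.differentiable _) (hb.differentiable _)]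
  simp [dirDeriv, uncurry3]
  ring

lemma dx_eq_dirDeriv {w : ℝ → ℝ → ℝ → ℝ} (hw : Smooth3 w) :
    dx w = dirDeriv (1, 0, 0) w := by
  funext x y t
  have hc : HasDerivAt (fun s : ℝ => (s, y, t)) ((1 : ℝ), (0 : ℝ), (0 : ℝ)) x :=
    (hasDerivAt_id x).prodMk ((hasDerivAt_const x y).prodMk (hasDerivAt_const x t))
  exact ((hw.differentiable (x, y, t)).hasFDerivAt.comp_hasDerivAt x hc).deriv

lemma dy_eq_dirDeriv {w : ℝ → ℝ → ℝ → ℝ} (hw : Smooth3 w) :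
    dy w = dirDeriv (0, 1, 0) w := by
  funext x y t
  have hc : HasDerivAt (fun s : ℝ => (x, s, t)) ((0 : ℝ), (1 : ℝ), (0 : ℝ)) y :=
    (hasDerivAt_const y x).prodMk ((hasDerivAt_id y).prodMk (hasDerivAt_const y t))
  exact ((hw.differentiable (x, y, t)).hasFDerivAt.comp_hasDerivAt y hc).deriv

lemma dt_eq_dirDeriv {w : ℝ → ℝ → ℝ → ℝ} (hw : Smooth3 w) :
    dt w = dirDeriv (0, 0, 1) w := by
  funext x y t
  have hc : HasDerivAt (fun s : ℝ => (x, y, s)) ((0 : ℝ), (0 : ℝ), (1 : ℝ)) t :=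
    (hasDerivAt_const t x).prodMk ((hasDerivAt_const t y).prodMk (hasDerivAt_id t))
  exact ((hw.differentiable (x, y, t)).hasFDerivAt.comp_hasDerivAt t hc).deriv

lemma Smooth3.dx {w : ℝ → ℝ → ℝ → ℝ} (hw : Smooth3 w) : Smooth3 (dx w) :=
  dx_eq_dirDeriv hw ▸ hw.dirDeriv _

lemma Smooth3.dy {w : ℝ → ℝ → ℝ → ℝ} (hw : Smooth3 w) : Smooth3 (dy w) :=
  dy_eq_dirDeriv hw ▸ hw.dirDeriv _

lemma Smooth3.dt {w : ℝ → ℝ → ℝ → ℝ} (hw : Smooth3 w) : Smooth3 (dt w) :=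
  dt_eq_dirDeriv hw ▸ hw.dirDeriv _

lemma Smooth3.add {a b : ℝ → ℝ → ℝ → ℝ} (ha : Smooth3 a) (hb : Smooth3 b) :
    Smooth3 (a + b) :=
  ContDiff.add ha hb

lemma Smooth3.mul {a b : ℝ → ℝ → ℝ → ℝ} (ha : Smooth3 a) (hb : Smooth3 b) :
    Smooth3 (a * b) :=
  ContDiff.mul ha hb

lemma dy_dx {w : ℝ → ℝ → ℝ → ℝ} (hw : Smooth3 w) : dy (dx w) = dx (dy w) := by
  rw [dy_eq_dirDeriv hw.dx, dx_eq_dirDeriv hw.dy, dx_eq_dirDeriv hw, dy_eq_dirDeriv hw,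
    dirDeriv_comm hw]

lemma dt_dx {w : ℝ → ℝ → ℝ → ℝ} (hw : Smooth3 w) : dt (dx w) = dx (dt w) := by
  rw [dt_eq_dirDeriv hw.dx, dx_eq_dirDeriv hw.dt, dx_eq_dirDeriv hw, dt_eq_dirDeriv hw,
    dirDeriv_comm hw]

lemma dt_dy {w : ℝ → ℝ → ℝ → ℝ} (hw : Smooth3 w) : dt (dy w) = dy (dt w) := by
  rw [dt_eq_dirDeriv hw.dy, dy_eq_dirDeriv hw.dt, dy_eq_dirDeriv hw, dt_eq_dirDeriv hw,
    dirDeriv_comm hw]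

lemma dx_add {a b : ℝ → ℝ → ℝ → ℝ} (ha : Smooth3 a) (hb : Smooth3 b) :
    dx (a + b) = dx a + dx b := by
  rw [dx_eq_dirDeriv (ha.add hb), dx_eq_dirDeriv ha, dx_eq_dirDeriv hb, dirDeriv_add ha hb]

lemma dy_add {a b : ℝ → ℝ → ℝ → ℝ} (ha : Smooth3 a) (hb : Smooth3 b) :
    dy (a + b) = dy a + dy b := by
  rw [dy_eq_dirDeriv (ha.add hb), dy_eq_dirDeriv ha, dy_eq_dirDeriv hb, dirDeriv_add ha hb]

lemma dt_add {a b : ℝ → ℝ → ℝ → ℝ} (ha : Smooth3 a) (hb : Smooth3 b) :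
    dt (a + b) = dt a + dt b := by
  rw [dt_eq_dirDeriv (ha.add hb), dt_eq_dirDeriv ha, dt_eq_dirDeriv hb, dirDeriv_add ha hb]

lemma dx_mul {a b : ℝ → ℝ → ℝ → ℝ} (ha : Smooth3 a) (hb : Smooth3 b) :
    dx (a * b) = dx a * b + a * dx b := by
  rw [dx_eq_dirDeriv (ha.mul hb), dx_eq_dirDeriv ha, dx_eq_dirDeriv hb, dirDeriv_mul ha hb]

lemma dy_mul {a b : ℝ → ℝ → ℝ → ℝ} (ha : Smooth3 a) (hb : Smooth3 b) :
    dy (a * b) = dy a * b + a * dy b := by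
  rw [dy_eq_dirDeriv (ha.mul hb), dy_eq_dirDeriv ha, dy_eq_dirDeriv hb, dirDeriv_mul ha hb]

lemma dt_mul {a b : ℝ → ℝ → ℝ → ℝ} (ha : Smooth3 a) (hb : Smooth3 b) :
    dt (a * b) = dt a * b + a * dt b := by
  rw [dt_eq_dirDeriv (ha.mul hb), dt_eq_dirDeriv ha, dt_eq_dirDeriv hb, dirDeriv_mul ha hb]

/-- The constant function of three variables. -/
def const3 (c : ℝ) : ℝ → ℝ → ℝ → ℝ := fun _ _ _ => c

/-- The first coordinate function. -/
def coordX : ℝ → ℝ → ℝ → ℝ := fun x _ _ => x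

/-- The second coordinate function. -/
def coordY : ℝ → ℝ → ℝ → ℝ := fun _ y _ => y

/-- A function of `t` alone, regarded as a function of three variables. -/
def ofTime (g : ℝ → ℝ) : ℝ → ℝ → ℝ → ℝ := fun _ _ t => g t

lemma smooth3_const3 (c : ℝ) : Smooth3 (const3 c) := contDiff_const

lemma smooth3_coordX : Smooth3 coordX := contDiff_fst

lemma smooth3_coordY : Smooth3 coordY := contDiff_fst.comp contDiff_snd

lemma smooth3_ofTime {g : ℝ → ℝ} (hg : ContDiff ℝ (⊤ : ℕ∞) g) : Smooth3 (ofTime g) :=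
  hg.comp (contDiff_snd.comp contDiff_snd)

lemma dx_const3 (c : ℝ) : dx (const3 c) = const3 0 := by
  funext x y t; simp [dx, const3]

lemma dy_const3 (c : ℝ) : dy (const3 c) = const3 0 := by
  funext x y t; simp [dy, const3]

lemma dt_const3 (c : ℝ) : dt (const3 c) = const3 0 := by
  funext x y t; simp [dt, const3]

lemma dx_coordX : dx coordX = const3 1 := by
  funext x y t; simp [dx, const3, coordX]

lemma dy_coordX : dy coordX = const3 0 := by
  funext x y t; simp [dy, const3, coordX]

lemma dt_coordX : dt coordX = const3 0 := by
  funext x y t; simp [dt, const3, coordX]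

lemma dx_coordY : dx coordY = const3 0 := by
  funext x y t; simp [dx, const3, coordY]

lemma dy_coordY : dy coordY = const3 1 := by
  funext x y t; simp [dy, const3, coordY]

lemma dt_coordY : dt coordY = const3 0 := by
  funext x y t; simp [dt, const3, coordY]

lemma dx_ofTime (g : ℝ → ℝ) : dx (ofTime g) = const3 0 := by
  funext x y t; simp [dx, const3, ofTime]

lemma dy_ofTime (g : ℝ → ℝ) : dy (ofTime g) = const3 0 := by
  funext x y t; simp [dy, const3, ofTime]

lemma dt_ofTime (g : ℝ → ℝ) : dt (ofTime g) = ofTime (deriv g) := rfl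

lemma const3_zero : const3 0 = 0 := rfl

lemma const3_one : const3 1 = 1 := rfl

lemma dx_zero : dx 0 = 0 := dx_const3 0

lemma dy_zero : dy 0 = 0 := dy_const3 0

lemma dt_zero : dt 0 = 0 := dt_const3 0

/-- The left-hand side of the KP₄ equation. -/
def kp4Lhs (w : ℝ → ℝ → ℝ → ℝ) : ℝ → ℝ → ℝ → ℝ :=
  dx (dx (dx (dx (dy w)))) + const3 6 * (dx (dx w) * dx (dy w))
    + const3 4 * (dx w * dx (dx (dy w))) + const3 2 * (dx (dx (dx w)) * dy w)
    + const3 (-2) * dx (dx (dt w)) + dy (dy (dy w))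

lemma KP4.kp4Lhs_eq_zero {w : ℝ → ℝ → ℝ → ℝ} (h : KP4 w) : kp4Lhs w = 0 := by
  funext x y t
  have := h x y t
  simp only [kp4Lhs, const3, Pi.add_apply, Pi.mul_apply, Pi.zero_apply]
  linear_combination this

/-- The Virasoro (time-reparametrization) flow `T(f)` is a symmetry of KP₄. -/
theorem stmt16 (w : ℝ → ℝ → ℝ → ℝ) (hw : Smooth3 w) (hsol : KP4 w)
    (f : ℝ → ℝ) (hf : ContDiff ℝ (⊤ : ℕ∞) f) :
    LinKP4 w (fun x y t =>
      f t * dt w x y t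
      + (1/4) * deriv f t * (x * dx w x y t + 2 * y * dy w x y t)
      + (1/4) * (w x y t * deriv f t + x * y * deriv (deriv f) t)) := by
  have hf' : ContDiff ℝ (⊤ : ℕ∞) (deriv f) := (contDiff_infty_iff_deriv.1 hf).2
  have hf'' : ContDiff ℝ (⊤ : ℕ∞) (deriv (deriv f)) := (contDiff_infty_iff_deriv.1 hf').2
  have hF := smooth3_ofTime hf
  have hF' := smooth3_ofTime hf'
  have hF'' := smooth3_ofTime hf''
  have hF''' := smooth3_ofTime (contDiff_infty_iff_deriv.1 hf'').2
  have hX := smooth3_coordX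
  have hY := smooth3_coordY
  have hE := hsol.kp4Lhs_eq_zero
  have hEx : dx (kp4Lhs w) = 0 := by rw [hE, dx_zero]
  have hEy : dy (kp4Lhs w) = 0 := by rw [hE, dy_zero]
  have hEt : dt (kp4Lhs w) = 0 := by rw [hE, dt_zero]
  have hQ : (fun x y t =>
      f t * dt w x y t
      + (1/4) * deriv f t * (x * dx w x y t + 2 * y * dy w x y t)
      + (1/4) * (w x y t * deriv f t + x * y * deriv (deriv f) t)) =
      ofTime f * dt w
      + const3 (1/4) * (ofTime (deriv f) * (coordX * dx w + const3 2 * (coordY * dy w) + w))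
      + const3 (1/4) * (ofTime (deriv (deriv f)) * (coordX * coordY)) := by
    funext x y t
    simp only [ofTime, const3, coordX, coordY, Pi.add_apply, Pi.mul_apply]
    ring
  rw [hQ]
  intro x y t
  have e := congrFun₃ hE x y t
  have ex := congrFun₃ hEx x y t
  have ey := congrFun₃ hEy x y t
  have et := congrFun₃ hEt x y t
  simp (maxDischargeDepth := 20) only [kp4Lhs, dx_add, dx_mul, dy_add, dy_mul, dt_add, dt_mul, dy_dx, dt_dx, dt_dy,
    Smooth3.add, Smooth3.mul, Smooth3.dx, Smooth3.dy, Smooth3.dt, smooth3_const3,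
    dx_const3, dy_const3, dt_const3, dx_coordX, dy_coordX, dt_coordX,
    dx_coordY, dy_coordY, dt_coordY, dx_ofTime, dy_ofTime, dt_ofTime,
    hw, hF, hF', hF'', hF''', hX, hY, const3_zero, const3_one,
    zero_mul, mul_zero, zero_add, add_zero, one_mul, mul_one] at e ex ey et ⊢
  simp only [Pi.add_apply, Pi.mul_apply, Pi.zero_apply, const3, ofTime, coordX, coordY]
    at e ex ey et ⊢
  linear_combination f t * et + deriv f t / 4 * (x * ex + 2 * y * ey + 7 * e)
end
end
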